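/- Let Φ : ℝ² → ℂ be a Schwartz function. Then for every complex number s with Re(s) > 0 the integral Z(s) = ∫_{ℝ²} Φ(x,y)·sgn(x·y)·|x·y|^{s−1} dx dy converges absolutely, and there exists an entire function G : ℂ → ℂ such that Z(s) = Γ((s+1)/2)²·G(s) for all s with Re(s) > 0. In particular the sign-twisted Mellin transform of the split orbital integrals of Φ extends holomorphically past s = 0 (its possible poles are at s = −1, −3, −5, …). -/

import Mathlib

open MeasureTheory

/-- The quasi-character `x ↦ sgn(x) |x|^{s-1}` of `ℝˣ`, extended by zero to `ℝ`. -/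
noncomputable def signChar (s : ℂ) (x : ℝ) : ℂ :=
  ((Real.sign x : ℝ) : ℂ) * ((|x| : ℝ) : ℂ) ^ (s - 1)

lemma Real.sign_mul_eq (x y : ℝ) : Real.sign (x * y) = Real.sign x * Real.sign y := by
  rcases lt_trichotomy x 0 with hx | rfl | hx <;> rcases lt_trichotomy y 0 with hy | rfl | hy <;>
    simp [Real.sign_of_neg, Real.sign_of_pos, mul_pos_of_neg_of_neg, mul_neg_of_neg_of_pos,
      mul_neg_of_pos_of_neg, *]

lemma signChar_mul (s : ℂ) (x y : ℝ) : signChar s (x * y) = signChar s x * signChar s y := by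
  simp only [signChar, Real.sign_mul_eq, abs_mul, Complex.ofReal_mul,
    Complex.mul_cpow_ofReal_nonneg (abs_nonneg x) (abs_nonneg y)]
  ring

lemma Real.abs_sign_of_ne_zero {x : ℝ} (hx : x ≠ 0) : |Real.sign x| = 1 := by
  rcases Real.sign_apply_eq_of_ne_zero x hx with h | h <;> simp [h]

lemma norm_signChar (s : ℂ) {x : ℝ} (hx : x ≠ 0) : ‖signChar s x‖ = |x| ^ (s.re - 1) := by
  rw [signChar, norm_mul, Complex.norm_real, Real.norm_eq_abs, Real.abs_sign_of_ne_zero hx,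
    Complex.norm_cpow_eq_rpow_re_of_pos (abs_pos.2 hx)]
  simp

lemma norm_signChar_le (s : ℂ) (x : ℝ) : ‖signChar s x‖ ≤ |x| ^ (s.re - 1) := by
  rcases eq_or_ne x 0 with rfl | hx
  · simp only [signChar, Real.sign_zero, Complex.ofReal_zero, zero_mul, norm_zero]
    positivity
  · exact (norm_signChar s hx).le

lemma signChar_mul_signChar_one_sub (s : ℂ) {x : ℝ} (hx : x ≠ 0) :
    signChar s x * signChar (1 - s) x = ((|x|⁻¹ : ℝ) : ℂ) := by
  have hx' : ((|x| : ℝ) : ℂ) ≠ 0 := by simpa using hx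
  have h1 : ((Real.sign x : ℝ) : ℂ) * ((Real.sign x : ℝ) : ℂ) = 1 := by
    rcases Real.sign_apply_eq_of_ne_zero x hx with h | h <;> simp [h]
  rw [signChar, signChar, mul_mul_mul_comm, h1, one_mul, ← Complex.cpow_add _ _ hx',
    show s - 1 + (1 - s - 1) = -1 by ring, Complex.cpow_neg_one, Complex.ofReal_inv]

lemma signChar_ne_zero (s : ℂ) {x : ℝ} (hx : x ≠ 0) : signChar s x ≠ 0 := by
  rw [← norm_pos_iff, norm_signChar s hx]
  exact Real.rpow_pos_of_pos (abs_pos.2 hx) _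

lemma Real.measurable_sign : Measurable Real.sign := by
  unfold Real.sign
  exact Measurable.ite measurableSet_Iio measurable_const
    (Measurable.ite measurableSet_Ioi measurable_const measurable_const)

@[fun_prop]
lemma measurable_signChar (s : ℂ) : Measurable (signChar s) := by
  unfold signChar
  have := Real.measurable_sign
  fun_prop

lemma hasDerivAt_signChar {x : ℝ} (hx : x ≠ 0) (s : ℂ) :
    HasDerivAt (fun s => signChar s x) (signChar s x * (Real.log |x| : ℝ)) s := by
  have hx' : ((|x| : ℝ) : ℂ) ≠ 0 := by simpa using hx
  have h := (((hasDerivAt_id s).sub_const 1).const_cpow (c := ((|x| : ℝ) : ℂ))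
    (Or.inl hx')).const_mul ((Real.sign x : ℝ) : ℂ)
  refine h.congr_deriv ?_
  simp only [signChar, id, Complex.ofReal_log (abs_nonneg x)]
  ring

section Even

variable {E : Type*} [NormedAddCommGroup E]

lemma MeasureTheory.IntegrableOn.integrable_comp_abs {f : ℝ → E}
    (hf : IntegrableOn f (Set.Ioi 0)) : Integrable (fun x => f |x|) := by
  have h1 : IntegrableOn (fun x => f |x|) (Set.Ioi 0) :=
    hf.congr_fun (fun x hx => by simp [abs_of_pos (Set.mem_Ioi.1 hx)]) measurableSet_Ioi
  have h2 : IntegrableOn (fun x => f |x|) (Set.Iic 0) := by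
    rw [← Measure.map_neg_eq_self (volume : Measure ℝ)]
    have m : MeasurableEmbedding fun x : ℝ => -x := (Homeomorph.neg ℝ).measurableEmbedding
    rw [m.integrableOn_map_iff]
    simp_rw [Function.comp_def, abs_neg, Set.neg_preimage, Set.neg_Iic, neg_zero]
    exact Iff.mpr integrableOn_Ici_iff_integrableOn_Ioi h1
  rw [← integrableOn_univ, ← Set.Iic_union_Ioi (a := (0 : ℝ))]
  exact h2.union h1

lemma MeasureTheory.IntegrableOn.integral_comp_abs [NormedSpace ℝ E] {f : ℝ → E}
    (hf : IntegrableOn f (Set.Ioi 0)) : ∫ x, f |x| = (2 : ℝ) • ∫ x in Set.Ioi (0 : ℝ), f x := by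
  have h := hf.integrable_comp_abs
  have h1 : ∫ x in Set.Ioi (0 : ℝ), f |x| = ∫ x in Set.Ioi (0 : ℝ), f x :=
    setIntegral_congr_fun measurableSet_Ioi fun x hx => by simp [abs_of_pos (Set.mem_Ioi.1 hx)]
  have h2 : ∫ x in Set.Iic (0 : ℝ), f |x| = ∫ x in Set.Ioi (0 : ℝ), f |x| := by
    have := integral_comp_neg_Iic 0 (fun x => f |x|)
    simpa using this
  rw [← setIntegral_univ, ← Set.Iic_union_Ioi (a := (0 : ℝ)),
    setIntegral_union (Set.Iic_disjoint_Ioi le_rfl) measurableSet_Ioi h.integrableOn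
      h.integrableOn, h2, h1, two_smul]

end Even

lemma integrable_abs_rpow_mul_one_add_abs_pow_inv {r : ℝ} (hr : -1 < r) {k : ℕ}
    (hk : |r| + 2 ≤ k) : Integrable (fun x : ℝ => |x| ^ r * ((1 + |x|) ^ k)⁻¹) := by
  have h1 : Integrable (fun x : ℝ => Real.exp 1 * (|x| ^ r * Real.exp (-1 * |x| ^ 2))) :=
    ((integrableOn_rpow_mul_exp_neg_mul_sq one_pos hr).integrable_comp_abs).const_mul _
  have h2 : Integrable (fun x : ℝ => (1 + ‖x‖) ^ (-2 : ℝ)) :=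
    integrable_one_add_norm (by simp)
  refine (h1.add h2).mono' (by fun_prop) (Filter.Eventually.of_forall fun x => ?_)
  rw [Real.norm_of_nonneg (by positivity), Pi.add_apply, Real.norm_eq_abs]
  have hx := abs_nonneg x
  generalize |x| = t at hx
  rcases le_total t 1 with ht | ht
  · have e1 : 1 ≤ Real.exp 1 * Real.exp (-1 * t ^ 2) := by
      rw [← Real.exp_add, Real.one_le_exp_iff]
      nlinarith
    have e2 : ((1 + t) ^ k)⁻¹ ≤ 1 := inv_le_one_of_one_le₀ (one_le_pow₀ (by linarith))
    have e3 : 0 ≤ t ^ r := by positivity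
    have e4 : 0 ≤ (1 + t) ^ (-2 : ℝ) := by positivity
    nlinarith [mul_le_mul_of_nonneg_left e1 e3, mul_le_mul_of_nonneg_left e2 e3]
  · have e1 : t ^ r ≤ (1 + t) ^ ((k : ℝ) - 2) :=
      (Real.rpow_le_rpow_of_exponent_le ht (by linarith [le_abs_self r])).trans
        (Real.rpow_le_rpow hx (by linarith) (by linarith [abs_nonneg r]))
    have e2 : (1 + t) ^ ((k : ℝ) - 2) * ((1 + t) ^ k)⁻¹ = (1 + t) ^ (-2 : ℝ) := by
      rw [← Real.rpow_natCast, ← Real.rpow_neg (by linarith), ← Real.rpow_add (by linarith)]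
      congr 1
      ring
    have e3 : 0 ≤ Real.exp 1 * (t ^ r * Real.exp (-1 * t ^ 2)) := by positivity
    have e4 : t ^ r * ((1 + t) ^ k)⁻¹ ≤ (1 + t) ^ ((k : ℝ) - 2) * ((1 + t) ^ k)⁻¹ := by gcongr
    linarith

/-- A Schwartz function on `ℝ²` is integrable against `|xy|^r` for `r > -1`. -/
lemma SchwartzMap.integrable_norm_mul_abs_rpow (Φ : SchwartzMap (ℝ × ℝ) ℂ) {r : ℝ}
    (hr : -1 < r) : Integrable (fun q : ℝ × ℝ => ‖Φ q‖ * |q.1 * q.2| ^ r) := by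
  obtain ⟨k, hk⟩ := exists_nat_ge (|r| + 2)
  obtain ⟨C, hC⟩ : ∃ C, ∀ q, (1 + ‖q‖) ^ (2 * k) * ‖Φ q‖ ≤ C :=
    ⟨_, fun q => by
      simpa using SchwartzMap.one_add_le_sup_seminorm_apply (𝕜 := ℝ) (m := (2 * k, 0)) (k := 2 * k)
        (n := 0) le_rfl le_rfl Φ q⟩
  have h1 := integrable_abs_rpow_mul_one_add_abs_pow_inv hr hk
  refine ((h1.mul_prod h1).const_mul C).mono' ?_ (Filter.Eventually.of_forall fun q => ?_)
  · exact (Φ.continuous.norm.measurable.mul (by fun_prop)).aestronglyMeasurable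
  rw [Real.norm_of_nonneg (by positivity), abs_mul, Real.mul_rpow (abs_nonneg _) (abs_nonneg _)]
  have e1 : (1 + |q.1|) ^ k * (1 + |q.2|) ^ k * ‖Φ q‖ ≤ C := by
    refine le_trans ?_ (hC q)
    rw [two_mul, pow_add]
    have a1 : |q.1| ≤ ‖q‖ := norm_fst_le q
    have a2 : |q.2| ≤ ‖q‖ := norm_snd_le q
    gcongr
  have e2 : ‖Φ q‖ ≤ C * (((1 + |q.1|) ^ k)⁻¹ * ((1 + |q.2|) ^ k)⁻¹) := by
    rw [← mul_inv, ← div_eq_mul_inv, le_div_iff₀ (by positivity)]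
    linarith
  calc ‖Φ q‖ * (|q.1| ^ r * |q.2| ^ r)
      ≤ C * (((1 + |q.1|) ^ k)⁻¹ * ((1 + |q.2|) ^ k)⁻¹) * (|q.1| ^ r * |q.2| ^ r) := by gcongr
    _ = _ := by ring

lemma SchwartzMap.integrable_mul_signChar (Φ : SchwartzMap (ℝ × ℝ) ℂ) {s : ℂ} (hs : 0 < s.re) :
    Integrable (fun q : ℝ × ℝ => Φ q * signChar s (q.1 * q.2)) := by
  refine (Φ.integrable_norm_mul_abs_rpow (r := s.re - 1) (by linarith)).mono'
    (Φ.continuous.measurable.mul (by fun_prop)).aestronglyMeasurable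
    (Filter.Eventually.of_forall fun q => ?_)
  rw [norm_mul]
  gcongr
  exact norm_signChar_le s _

/-- The sign-twisted two-variable zeta integral `∫ Φ(x,y) sgn(xy) |xy|^{s-1} dx dy`. -/
noncomputable def signZeta (f : ℝ × ℝ → ℂ) (s : ℂ) : ℂ :=
  ∫ q : ℝ × ℝ, f q * signChar s (q.1 * q.2)

lemma ae_fst_mul_snd_ne_zero : ∀ᵐ q : ℝ × ℝ, q.1 * q.2 ≠ 0 := by
  have h : ∀ᵐ x : ℝ, x ≠ 0 := by simp [ae_iff]
  have h1 : ∀ᵐ q : ℝ × ℝ, q.1 ≠ 0 := Measure.quasiMeasurePreserving_fst.ae h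
  have h2 : ∀ᵐ q : ℝ × ℝ, q.2 ≠ 0 := Measure.quasiMeasurePreserving_snd.ae h
  filter_upwards [h1, h2] with q a b using mul_ne_zero a b

lemma abs_log_le_rpow_add_rpow {t ε : ℝ} (ht : 0 < t) (hε : 0 < ε) :
    |Real.log t| ≤ t ^ ε / ε + t ^ (-ε) / ε := by
  have h1 := Real.log_le_rpow_div ht.le hε
  have h2 := Real.log_le_rpow_div (inv_pos.2 ht).le hε
  rw [Real.log_inv, Real.inv_rpow ht.le, ← Real.rpow_neg ht.le] at h2
  have h3 : 0 ≤ t ^ ε / ε := by positivity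
  have h4 : 0 ≤ t ^ (-ε) / ε := by positivity
  rw [abs_le]
  constructor <;> linarith

lemma SchwartzMap.differentiableAt_signZeta (Φ : SchwartzMap (ℝ × ℝ) ℂ) {s : ℂ}
    (hs : 0 < s.re) : DifferentiableAt ℂ (signZeta Φ) s := by
  set ε := s.re / 4 with hε
  have hε0 : 0 < ε := by positivity
  have hint (r : ℝ) (hr : -1 < r) := Φ.integrable_norm_mul_abs_rpow hr
  have hbound : Integrable (fun q : ℝ × ℝ =>
      (‖Φ q‖ * |q.1 * q.2| ^ (s.re - 1 + 2 * ε) + ‖Φ q‖ * |q.1 * q.2| ^ (s.re - 1) +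
        (‖Φ q‖ * |q.1 * q.2| ^ (s.re - 1) + ‖Φ q‖ * |q.1 * q.2| ^ (s.re - 1 - 2 * ε))) / ε) :=
    (((hint _ (by linarith)).add (hint _ (by linarith))).add
      ((hint _ (by linarith)).add (hint _ (by linarith)))).div_const _
  refine (hasDerivAt_integral_of_dominated_loc_of_deriv_le (Metric.ball_mem_nhds s hε0)
    (F := fun s q => Φ q * signChar s (q.1 * q.2))
    (F' := fun s q => Φ q * (signChar s (q.1 * q.2) * (Real.log |q.1 * q.2| : ℝ)))
    (Filter.Eventually.of_forall fun z =>
      (Φ.continuous.measurable.mul (by fun_prop)).aestronglyMeasurable)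
    (Φ.integrable_mul_signChar hs)
    (Φ.continuous.measurable.mul (by fun_prop)).aestronglyMeasurable
    ?_ hbound ?_).2.differentiableAt
  · filter_upwards [ae_fst_mul_snd_ne_zero] with q hq z hz
    have hre : |z.re - s.re| < ε := by
      refine lt_of_le_of_lt ?_ (mem_ball_iff_norm.1 hz)
      simpa using Complex.abs_re_le_norm (z - s)
    rw [abs_lt] at hre
    rw [norm_mul, norm_mul, norm_signChar z hq, Complex.norm_real, Real.norm_eq_abs]
    have ht := abs_pos.2 hq
    generalize |q.1 * q.2| = t at ht
    have hpow : t ^ (z.re - 1) ≤ t ^ (s.re - 1 + ε) + t ^ (s.re - 1 - ε) := by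
      have p1 : 0 < t ^ (s.re - 1 + ε) := by positivity
      have p2 : 0 < t ^ (s.re - 1 - ε) := by positivity
      rcases le_total t 1 with h | h
      · linarith [Real.rpow_le_rpow_of_exponent_ge ht h
          (by linarith : s.re - 1 - ε ≤ z.re - 1)]
      · linarith [Real.rpow_le_rpow_of_exponent_le h
          (by linarith : z.re - 1 ≤ s.re - 1 + ε)]
    have e1 : t ^ (s.re - 1 + ε) * t ^ ε = t ^ (s.re - 1 + 2 * ε) := by
      rw [← Real.rpow_add ht]; ring_nf
    have e2 : t ^ (s.re - 1 + ε) * t ^ (-ε) = t ^ (s.re - 1) := by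
      rw [← Real.rpow_add ht]; ring_nf
    have e3 : t ^ (s.re - 1 - ε) * t ^ ε = t ^ (s.re - 1) := by
      rw [← Real.rpow_add ht]; ring_nf
    have e4 : t ^ (s.re - 1 - ε) * t ^ (-ε) = t ^ (s.re - 1 - 2 * ε) := by
      rw [← Real.rpow_add ht]; ring_nf
    calc ‖Φ q‖ * (t ^ (z.re - 1) * |Real.log t|)
        ≤ ‖Φ q‖ * ((t ^ (s.re - 1 + ε) + t ^ (s.re - 1 - ε)) * (t ^ ε / ε + t ^ (-ε) / ε)) := by
          gcongr
          exact abs_log_le_rpow_add_rpow ht hε0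
      _ = _ := by
          rw [← e1, ← e2, ← e4]
          linear_combination (‖Φ q‖ / ε) * (e3 - e2)
  · filter_upwards [ae_fst_mul_snd_ne_zero] with q hq z _
    exact (hasDerivAt_signChar hq z).const_mul (Φ q)

/-! ### The Fourier transform on `ℝ²` -/

/-- The Fourier kernel `e^{-2πi(x₁y₁ + x₂y₂)}` on `ℝ²`, as a function of `x * y`. -/
noncomputable def fourierKernel (q : ℝ × ℝ) : ℂ :=
  Complex.exp (((-(2 * Real.pi * (q.1 + q.2)) : ℝ) : ℂ) * Complex.I)

lemma norm_fourierKernel (q : ℝ × ℝ) : ‖fourierKernel q‖ = 1 :=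
  Complex.norm_exp_ofReal_mul_I _

@[fun_prop]
lemma continuous_fourierKernel : Continuous fourierKernel := by
  unfold fourierKernel
  fun_prop

/-- The Fourier transform of a function on `ℝ²`, with the standard bilinear pairing. -/
noncomputable def planeFourier (f : ℝ × ℝ → ℂ) (w : ℝ × ℝ) : ℂ :=
  ∫ p, f p * fourierKernel (p * w)

open FourierTransform SchwartzMap in
lemma SchwartzMap.exists_coe_eq_planeFourier (Φ : SchwartzMap (ℝ × ℝ) ℂ) :
    ∃ Ψ : SchwartzMap (ℝ × ℝ) ℂ, ⇑Ψ = planeFourier Φ := by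
  let e := WithLp.prodContinuousLinearEquiv 2 ℝ ℝ ℝ
  refine ⟨compCLMOfContinuousLinearEquiv ℂ e.symm (𝓕 (compCLMOfContinuousLinearEquiv ℂ e Φ)), ?_⟩
  ext w
  rw [compCLMOfContinuousLinearEquiv_apply, Function.comp_apply, fourier_coe,
    Real.fourier_eq', planeFourier, ← (WithLp.volume_preserving_ofLp ℝ ℝ).integral_comp
      (MeasurableEquiv.toLp 2 (ℝ × ℝ)).symm.measurableEmbedding]
  refine integral_congr_ae (Filter.Eventually.of_forall fun p => ?_)
  simp only [compCLMOfContinuousLinearEquiv_apply, Function.comp_apply, smul_eq_mul,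
    fourierKernel, WithLp.prod_inner_apply]
  rw [mul_comm]
  congr 3
  simp [e]
  ring

/-- The multiplication formula for the Fourier transform, in dilated form. -/
lemma integral_mul_planeFourier_comm {f g : ℝ × ℝ → ℂ} (hf : Integrable f) (hg : Integrable g)
    (w : ℝ × ℝ) :
    ∫ p, f p * planeFourier g (p * w) = ∫ p, g p * planeFourier f (p * w) := by
  have hint : Integrable (fun z : (ℝ × ℝ) × (ℝ × ℝ) =>
      f z.1 * g z.2 * fourierKernel (z.1 * z.2 * w)) (volume.prod volume) :=
    (hf.mul_prod hg).mul_bdd (c := 1) (by fun_prop)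
      (Filter.Eventually.of_forall fun z => (norm_fourierKernel _).le)
  calc ∫ p, f p * planeFourier g (p * w)
      = ∫ p, ∫ q, f p * g q * fourierKernel (p * q * w) := by
        refine integral_congr_ae (Filter.Eventually.of_forall fun p => ?_)
        simp only [planeFourier]
        rw [← integral_const_mul]
        refine integral_congr_ae (Filter.Eventually.of_forall fun q => ?_)
        simp only [mul_assoc, mul_left_comm q p w]
    _ = ∫ q, ∫ p, f p * g q * fourierKernel (p * q * w) := integral_integral_swap hint
    _ = ∫ p, g p * planeFourier f (p * w) := by
        refine integral_congr_ae (Filter.Eventually.of_forall fun p => ?_)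
        simp only [planeFourier]
        rw [← integral_const_mul]
        refine integral_congr_ae (Filter.Eventually.of_forall fun q => ?_)
        simp only [← mul_assoc, mul_comm (f q) (g p)]

/-! ### Dilations and the functional equation -/

lemma map_mul_left_volume_prod {p : ℝ × ℝ} (hp : p.1 * p.2 ≠ 0) :
    Measure.map (fun w => p * w) (volume : Measure (ℝ × ℝ)) =
      ENNReal.ofReal |p.1 * p.2|⁻¹ • volume := by
  obtain ⟨h1, h2⟩ := mul_ne_zero_iff.1 hp
  have h : (fun w : ℝ × ℝ => p * w) = Prod.map (p.1 * ·) (p.2 * ·) := rfl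
  rw [h, Measure.volume_eq_prod, ← Measure.map_prod_map _ _ (by fun_prop) (by fun_prop),
    Real.map_volume_mul_left h1, Real.map_volume_mul_left h2, Measure.prod_smul_left,
    Measure.prod_smul_right, smul_smul, ← ENNReal.ofReal_mul (abs_nonneg _), ← abs_mul,
    ← mul_inv, abs_inv]

lemma MeasureTheory.Integrable.comp_mul_left_prod {E : Type*} [NormedAddCommGroup E]
    {F : ℝ × ℝ → E} (hF : Integrable F) {p : ℝ × ℝ} (hp : p.1 * p.2 ≠ 0) :
    Integrable (fun w => F (p * w)) := by
  have h : Integrable F (Measure.map (fun w => p * w) volume) := by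
    rw [map_mul_left_volume_prod hp]
    exact hF.smul_measure ENNReal.ofReal_ne_top
  exact h.comp_measurable (by fun_prop)

lemma MeasureTheory.Integrable.integral_comp_mul_left_prod {E : Type*} [NormedAddCommGroup E]
    [NormedSpace ℝ E] {F : ℝ × ℝ → E} (hF : Integrable F) {p : ℝ × ℝ} (hp : p.1 * p.2 ≠ 0) :
    ∫ w, F (p * w) = |p.1 * p.2|⁻¹ • ∫ w, F w := by
  have h : Integrable F (Measure.map (fun w => p * w) volume) := by
    rw [map_mul_left_volume_prod hp]
    exact hF.smul_measure ENNReal.ofReal_ne_top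
  rw [← integral_map (φ := fun w => p * w) (by fun_prop) h.aestronglyMeasurable,
    map_mul_left_volume_prod hp, integral_smul_measure, ENNReal.toReal_ofReal (by positivity)]

lemma mul_signChar_eq_dilate (g : ℝ × ℝ → ℂ) (s : ℂ) {p : ℝ × ℝ} (hp : p.1 * p.2 ≠ 0)
    (w : ℝ × ℝ) :
    g (p * w) * signChar s (w.1 * w.2) = (signChar s (p.1 * p.2))⁻¹ *
      (g (p * w) * signChar s ((p * w).1 * (p * w).2)) := by
  have h := signChar_ne_zero s hp
  rw [Prod.fst_mul, Prod.snd_mul, mul_mul_mul_comm, signChar_mul s (p.1 * p.2)]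
  field_simp

lemma integrable_dilate_mul_signChar {g : ℝ × ℝ → ℂ} {s : ℂ}
    (hg : Integrable fun q : ℝ × ℝ => g q * signChar (1 - s) (q.1 * q.2))
    {p : ℝ × ℝ} (hp : p.1 * p.2 ≠ 0) :
    Integrable fun w : ℝ × ℝ => g (p * w) * signChar (1 - s) (w.1 * w.2) := by
  simp_rw [mul_signChar_eq_dilate g (1 - s) hp]
  exact (hg.comp_mul_left_prod hp).const_mul _

lemma integral_dilate_mul_signChar {g : ℝ × ℝ → ℂ} {s : ℂ}
    (hg : Integrable fun q : ℝ × ℝ => g q * signChar (1 - s) (q.1 * q.2))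
    {p : ℝ × ℝ} (hp : p.1 * p.2 ≠ 0) :
    ∫ w : ℝ × ℝ, g (p * w) * signChar (1 - s) (w.1 * w.2) =
      signChar s (p.1 * p.2) * signZeta g (1 - s) := by
  simp_rw [mul_signChar_eq_dilate g (1 - s) hp]
  rw [integral_const_mul, hg.integral_comp_mul_left_prod hp, Complex.real_smul,
    ← signChar_mul_signChar_one_sub s hp, signZeta]
  have h := signChar_ne_zero (1 - s) hp
  field_simp

lemma integral_norm_dilate_mul_signChar {g : ℝ × ℝ → ℂ} {s : ℂ}
    (hg : Integrable fun q : ℝ × ℝ => g q * signChar (1 - s) (q.1 * q.2))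
    {p : ℝ × ℝ} (hp : p.1 * p.2 ≠ 0) :
    ∫ w : ℝ × ℝ, ‖g (p * w) * signChar (1 - s) (w.1 * w.2)‖ =
      ‖signChar s (p.1 * p.2)‖ * ∫ w : ℝ × ℝ, ‖g w * signChar (1 - s) (w.1 * w.2)‖ := by
  have h := norm_ne_zero_iff.2 (signChar_ne_zero (1 - s) hp)
  have h' := congrArg norm (signChar_mul_signChar_one_sub s hp)
  rw [norm_mul, Complex.norm_real, Real.norm_of_nonneg (by positivity)] at h'
  simp_rw [mul_signChar_eq_dilate g (1 - s) hp]
  simp_rw [norm_mul (signChar (1 - s) (p.1 * p.2))⁻¹]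
  rw [integral_const_mul, hg.norm.integral_comp_mul_left_prod hp, ← h', smul_eq_mul, norm_inv]
  field_simp

lemma signZeta_mul_signZeta {f g : ℝ × ℝ → ℂ} {s : ℂ} (hfm : Measurable f) (hgm : Measurable g)
    (hf : Integrable fun q : ℝ × ℝ => f q * signChar s (q.1 * q.2))
    (hg : Integrable fun q : ℝ × ℝ => g q * signChar (1 - s) (q.1 * q.2)) :
    signZeta f s * signZeta g (1 - s) =
      ∫ w : ℝ × ℝ, (∫ p, f p * g (p * w)) * signChar (1 - s) (w.1 * w.2) := by
  have hint : Integrable (fun z : (ℝ × ℝ) × (ℝ × ℝ) =>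
      f z.1 * (g (z.1 * z.2) * signChar (1 - s) (z.2.1 * z.2.2))) (volume.prod volume) := by
    refine (integrable_prod_iff (by fun_prop)).2 ⟨?_, ?_⟩
    · filter_upwards [ae_fst_mul_snd_ne_zero] with p hp
      exact (integrable_dilate_mul_signChar hg hp).const_mul _
    · refine (hf.norm.mul_const (∫ w : ℝ × ℝ, ‖g w * signChar (1 - s) (w.1 * w.2)‖)).congr ?_
      filter_upwards [ae_fst_mul_snd_ne_zero] with p hp
      simp_rw [norm_mul (f p)]
      rw [integral_const_mul, integral_norm_dilate_mul_signChar hg hp, mul_assoc]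
  calc signZeta f s * signZeta g (1 - s)
      = ∫ p, ∫ w : ℝ × ℝ, f p * (g (p * w) * signChar (1 - s) (w.1 * w.2)) := by
        rw [signZeta, ← integral_mul_const]
        refine integral_congr_ae ?_
        filter_upwards [ae_fst_mul_snd_ne_zero] with p hp
        rw [integral_const_mul, integral_dilate_mul_signChar hg hp, mul_assoc]
    _ = ∫ w : ℝ × ℝ, ∫ p, f p * (g (p * w) * signChar (1 - s) (w.1 * w.2)) :=
        integral_integral_swap hint
    _ = _ := by simp_rw [← mul_assoc, integral_mul_const]

lemma signZeta_mul_signZeta_planeFourier_comm {f g : ℝ × ℝ → ℂ} {s : ℂ}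
    (hfi : Integrable f) (hgi : Integrable g) (hfm : Measurable f) (hgm : Measurable g)
    (hfm' : Measurable (planeFourier f)) (hgm' : Measurable (planeFourier g))
    (hf : Integrable fun q : ℝ × ℝ => f q * signChar s (q.1 * q.2))
    (hg : Integrable fun q : ℝ × ℝ => g q * signChar s (q.1 * q.2))
    (hf' : Integrable fun q : ℝ × ℝ => planeFourier f q * signChar (1 - s) (q.1 * q.2))
    (hg' : Integrable fun q : ℝ × ℝ => planeFourier g q * signChar (1 - s) (q.1 * q.2)) :
    signZeta f s * signZeta (planeFourier g) (1 - s) =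
      signZeta g s * signZeta (planeFourier f) (1 - s) := by
  rw [signZeta_mul_signZeta hfm hgm' hf hg', signZeta_mul_signZeta hgm hfm' hg hf']
  simp_rw [integral_mul_planeFourier_comm hfi hgi]

/-! ### The odd Gaussian -/

/-- The odd Gaussian `x e^{-πx²}`. -/
noncomputable def oddGaussian (x : ℝ) : ℂ := x * Complex.exp (-Real.pi * x ^ 2)

@[fun_prop]
lemma continuous_oddGaussian : Continuous oddGaussian := by
  unfold oddGaussian
  fun_prop

lemma integrable_oddGaussian : Integrable oddGaussian :=
  integrable_mul_cexp_neg_mul_sq (b := Real.pi) (by simpa using Real.pi_pos)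

lemma integral_oddGaussian_mul_cexp (t : ℝ) :
    ∫ x : ℝ, oddGaussian x * Complex.exp (((-(2 * Real.pi * (x * t)) : ℝ) : ℂ) * Complex.I) =
      -Complex.I * oddGaussian t := by
  have hpi : (Real.pi : ℂ) ≠ 0 := by exact_mod_cast Real.pi_ne_zero
  have hi1 : Integrable fun x : ℝ =>
      oddGaussian x * Complex.exp (((-(2 * Real.pi * (x * t)) : ℝ) : ℂ) * Complex.I) :=
    integrable_oddGaussian.mul_bdd (c := 1) (by fun_prop)
      (Filter.Eventually.of_forall fun x => (Complex.norm_exp_ofReal_mul_I _).le)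
  have hi0 : Integrable fun x : ℝ => Complex.exp (-Real.pi * x ^ 2 +
      (-2 * Real.pi * t * Complex.I) * x + 0) :=
    integrable_cexp_quadratic (by simpa using Real.pi_pos) _ _
  have hgauss : ∫ x : ℝ, Complex.exp (-Real.pi * x ^ 2 + (-2 * Real.pi * t * Complex.I) * x + 0) =
      Complex.exp (-Real.pi * t ^ 2) := by
    rw [integral_cexp_quadratic (by simpa using Real.pi_pos), neg_neg, div_self hpi,
      Complex.one_cpow, one_mul]
    congr 1
    field_simp
    rw [Complex.I_sq]
    ring
  have hd (x : ℝ) : HasDerivAt (fun x : ℝ => Complex.exp (-Real.pi * x ^ 2 +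
        (-2 * Real.pi * t * Complex.I) * x + 0))
      (-2 * Real.pi * (oddGaussian x *
        Complex.exp (((-(2 * Real.pi * (x * t)) : ℝ) : ℂ) * Complex.I)) +
        (-2 * Real.pi * t * Complex.I) * Complex.exp (-Real.pi * x ^ 2 +
          (-2 * Real.pi * t * Complex.I) * x + 0)) x := by
    have h : HasDerivAt (fun x : ℂ => Complex.exp (-Real.pi * x ^ 2 +
        (-2 * Real.pi * t * Complex.I) * x + 0)) _ (x : ℂ) :=
      (((((hasDerivAt_id (x : ℂ)).pow 2).const_mul (-Real.pi : ℂ)).add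
        ((hasDerivAt_id (x : ℂ)).const_mul (-2 * Real.pi * t * Complex.I))).add_const 0).cexp
    have hexp : oddGaussian x *
        Complex.exp (((-(2 * Real.pi * (x * t)) : ℝ) : ℂ) * Complex.I) =
        x * Complex.exp (-Real.pi * x ^ 2 + (-2 * Real.pi * t * Complex.I) * x + 0) := by
      rw [oddGaussian, mul_assoc, ← Complex.exp_add]
      push_cast
      ring_nf
    refine h.comp_ofReal.congr_deriv ?_
    rw [hexp]
    simp only [id, Pi.add_apply, Pi.pow_apply]
    push_cast
    ring
  have h0 := integral_eq_zero_of_hasDerivAt_of_integrable hd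
    ((hi1.const_mul _).add (hi0.const_mul _)) hi0
  rw [integral_add (hi1.const_mul _) (hi0.const_mul _), integral_const_mul, integral_const_mul,
    hgauss] at h0
  rw [oddGaussian]
  have h2 : (2 * Real.pi : ℂ) ≠ 0 := by simp
  refine mul_left_cancel₀ h2 ?_
  linear_combination -h0

/-- The function `xy e^{-π(x²+y²)}` on `ℝ²`. -/
noncomputable def planeOddGaussian (q : ℝ × ℝ) : ℂ := oddGaussian q.1 * oddGaussian q.2

@[fun_prop]
lemma continuous_planeOddGaussian : Continuous planeOddGaussian := by
  unfold planeOddGaussian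
  fun_prop

lemma integrable_planeOddGaussian : Integrable planeOddGaussian :=
  integrable_oddGaussian.mul_prod integrable_oddGaussian

lemma planeFourier_planeOddGaussian : planeFourier planeOddGaussian = -planeOddGaussian := by
  ext w
  have h (p : ℝ × ℝ) : planeOddGaussian p * fourierKernel (p * w) =
      (oddGaussian p.1 * Complex.exp (((-(2 * Real.pi * (p.1 * w.1)) : ℝ) : ℂ) * Complex.I)) *
      (oddGaussian p.2 * Complex.exp (((-(2 * Real.pi * (p.2 * w.2)) : ℝ) : ℂ) * Complex.I)) := by
    rw [planeOddGaussian, fourierKernel, mul_mul_mul_comm, ← Complex.exp_add, ← add_mul,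
      ← Complex.ofReal_add]
    congr 4
    simp only [Prod.fst_mul, Prod.snd_mul]
    ring
  simp only [planeFourier, h]
  rw [Measure.volume_eq_prod, integral_prod_mul (fun x : ℝ => oddGaussian x *
      Complex.exp (((-(2 * Real.pi * (x * w.1)) : ℝ) : ℂ) * Complex.I))
    (fun x : ℝ => oddGaussian x *
      Complex.exp (((-(2 * Real.pi * (x * w.2)) : ℝ) : ℂ) * Complex.I)),
    integral_oddGaussian_mul_cexp, integral_oddGaussian_mul_cexp, Pi.neg_apply, planeOddGaussian]
  linear_combination oddGaussian w.1 * oddGaussian w.2 * Complex.I_sq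

lemma oddGaussian_mul_signChar {s : ℂ} (hs : 0 < s.re) (x : ℝ) :
    oddGaussian x * signChar s x =
      ((|x| : ℝ) : ℂ) ^ s * Complex.exp (-Real.pi * ((|x| : ℝ) : ℂ) ^ 2) := by
  rcases eq_or_ne x 0 with rfl | hx
  · have hs0 : s ≠ 0 := by rintro rfl; simp at hs
    simp [oddGaussian, hs0]
  have hx' : ((|x| : ℝ) : ℂ) ≠ 0 := by simpa using hx
  have h1 : (x : ℂ) * ((Real.sign x : ℝ) : ℂ) = ((|x| : ℝ) : ℂ) := by
    rw [← Complex.ofReal_mul]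
    congr 1
    rcases hx.lt_or_gt with h | h
    · simp [Real.sign_of_neg h, abs_of_neg h]
    · simp [Real.sign_of_pos h, abs_of_pos h]
  have h2 : ((|x| : ℝ) : ℂ) ^ 2 = (x : ℂ) ^ 2 := by
    rw [← Complex.ofReal_pow, sq_abs, Complex.ofReal_pow]
  have h3 : ((|x| : ℝ) : ℂ) ^ s = ((|x| : ℝ) : ℂ) * ((|x| : ℝ) : ℂ) ^ (s - 1) := by
    rw [Complex.cpow_sub _ _ hx', Complex.cpow_one]
    field_simp
  rw [h2, h3, oddGaussian, signChar, ← h1]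
  ring

lemma integrableOn_cpow_mul_gaussian {s : ℂ} (hs : 0 < s.re) :
    IntegrableOn (fun t : ℝ => (t : ℂ) ^ s * Complex.exp (-Real.pi * (t : ℂ) ^ 2))
      (Set.Ioi 0) := by
  refine (integrableOn_rpow_mul_exp_neg_mul_sq Real.pi_pos (s := s.re) (by linarith)).mono'
    (Measurable.aestronglyMeasurable (by fun_prop)) ?_
  filter_upwards [self_mem_ae_restrict measurableSet_Ioi] with t ht
  rw [norm_mul, Complex.norm_cpow_eq_rpow_re_of_pos ht, Complex.norm_exp]
  norm_cast

lemma integrable_oddGaussian_mul_signChar {s : ℂ} (hs : 0 < s.re) :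
    Integrable fun x => oddGaussian x * signChar s x := by
  simp_rw [oddGaussian_mul_signChar hs]
  exact (integrableOn_cpow_mul_gaussian hs).integrable_comp_abs

lemma integral_oddGaussian_mul_signChar {s : ℂ} (hs : 0 < s.re) :
    ∫ x, oddGaussian x * signChar s x =
      (1 / (Real.pi : ℂ)) ^ ((s + 1) / 2) * Complex.Gamma ((s + 1) / 2) := by
  simp_rw [oddGaussian_mul_signChar hs]
  rw [(integrableOn_cpow_mul_gaussian hs).integral_comp_abs]
  have h1 := mellin_comp_rpow (fun t : ℝ => Complex.exp (-(Real.pi * t))) (s + 1) 2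
  have h2 : mellin (fun t : ℝ => Complex.exp (-(Real.pi * t))) ((s + 1) / 2) =
      (1 / (Real.pi : ℂ)) ^ ((s + 1) / 2) * Complex.Gamma ((s + 1) / 2) :=
    Complex.integral_cpow_mul_exp_neg_mul_Ioi (by simp; linarith) Real.pi_pos
  rw [Complex.ofReal_ofNat, h2] at h1
  have h3 : ∫ t in Set.Ioi (0 : ℝ), (t : ℂ) ^ s * Complex.exp (-Real.pi * (t : ℂ) ^ 2) =
      mellin (fun t : ℝ => Complex.exp (-(Real.pi * ((t ^ (2 : ℝ) : ℝ) : ℂ)))) (s + 1) := by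
    simp [mellin]
  rw [h3, h1, smul_smul]
  norm_num

lemma planeOddGaussian_mul_signChar (s : ℂ) (q : ℝ × ℝ) :
    planeOddGaussian q * signChar s (q.1 * q.2) =
      (oddGaussian q.1 * signChar s q.1) * (oddGaussian q.2 * signChar s q.2) := by
  rw [planeOddGaussian, signChar_mul, mul_mul_mul_comm]

lemma integrable_planeOddGaussian_mul_signChar {s : ℂ} (hs : 0 < s.re) :
    Integrable fun q : ℝ × ℝ => planeOddGaussian q * signChar s (q.1 * q.2) := by
  simp_rw [planeOddGaussian_mul_signChar]
  exact (integrable_oddGaussian_mul_signChar hs).mul_prod (integrable_oddGaussian_mul_signChar hs)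

lemma signZeta_planeOddGaussian {s : ℂ} (hs : 0 < s.re) :
    signZeta planeOddGaussian s =
      ((1 / (Real.pi : ℂ)) ^ ((s + 1) / 2) * Complex.Gamma ((s + 1) / 2)) ^ 2 := by
  simp_rw [signZeta, planeOddGaussian_mul_signChar]
  rw [Measure.volume_eq_prod, integral_prod_mul (fun x => oddGaussian x * signChar s x)
    (fun x => oddGaussian x * signChar s x), integral_oddGaussian_mul_signChar hs, sq]

/-- The local functional equation for the sign-twisted zeta integral. -/
lemma SchwartzMap.signZeta_functional_equation {Φ Ψ : SchwartzMap (ℝ × ℝ) ℂ}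
    (hΨ : ⇑Ψ = planeFourier Φ) {s : ℂ} (hs : 0 < s.re) (hs1 : s.re < 1) :
    signZeta Φ s * ((1 / (Real.pi : ℂ)) ^ ((2 - s) / 2) * Complex.Gamma ((2 - s) / 2)) ^ 2 =
      -(((1 / (Real.pi : ℂ)) ^ ((s + 1) / 2) * Complex.Gamma ((s + 1) / 2)) ^ 2 *
        signZeta Ψ (1 - s)) := by
  have hs' : 0 < (1 - s).re := by simpa using hs1
  have hneg : signZeta (-planeOddGaussian) (1 - s) = -signZeta planeOddGaussian (1 - s) := by
    simp [signZeta, integral_neg]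
  have hg := continuous_planeOddGaussian.measurable
  have h := signZeta_mul_signZeta_planeFourier_comm (s := s) Φ.integrable
    integrable_planeOddGaussian Φ.continuous.measurable hg
    (hΨ ▸ Ψ.continuous.measurable)
    (by rw [planeFourier_planeOddGaussian]; exact hg.neg)
    (Φ.integrable_mul_signChar hs) (integrable_planeOddGaussian_mul_signChar hs)
    (hΨ ▸ Ψ.integrable_mul_signChar hs')
    (by
      simpa [planeFourier_planeOddGaussian] using
        (integrable_planeOddGaussian_mul_signChar hs').neg)
  rw [planeFourier_planeOddGaussian, hneg, signZeta_planeOddGaussian hs,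
    signZeta_planeOddGaussian hs', ← hΨ, show (1 - s + 1) / 2 = (2 - s) / 2 by ring] at h
  linear_combination -h

lemma SchwartzMap.exists_differentiable_signZeta_eq (Φ : SchwartzMap (ℝ × ℝ) ℂ) :
    ∃ G : ℂ → ℂ, Differentiable ℂ G ∧
      ∀ s : ℂ, 0 < s.re → signZeta Φ s = Complex.Gamma ((s + 1) / 2) ^ 2 * G s := by
  obtain ⟨Ψ, hΨ⟩ := Φ.exists_coe_eq_planeFourier
  have hpi : (1 / (Real.pi : ℂ)) ≠ 0 := by simp
  let G₁ : ℂ → ℂ := fun s => signZeta Φ s * ((Complex.Gamma ((s + 1) / 2))⁻¹) ^ 2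
  let G₂ : ℂ → ℂ := fun s => -(((1 / (Real.pi : ℂ)) ^ ((s + 1) / 2)) ^ 2 *
    signZeta Ψ (1 - s) * ((1 / (Real.pi : ℂ)) ^ (-((2 - s) / 2))) ^ 2 *
      ((Complex.Gamma ((2 - s) / 2))⁻¹) ^ 2)
  have hΓ {z : ℂ} (hz : 0 < z.re) : Complex.Gamma ((z + 1) / 2) ≠ 0 :=
    Complex.Gamma_ne_zero_of_re_pos (by simp; linarith)
  have hG₁ {s : ℂ} (hs : 0 < s.re) : DifferentiableAt ℂ G₁ s := by
    have h : DifferentiableAt ℂ (fun s : ℂ => (Complex.Gamma ((s + 1) / 2))⁻¹) s :=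
      (Complex.differentiable_one_div_Gamma _).comp s
        (f := fun s : ℂ => (s + 1) / 2) (by fun_prop)
    exact (Φ.differentiableAt_signZeta hs).mul (h.pow 2)
  have hG₂ {s : ℂ} (hs : s.re < 1) : DifferentiableAt ℂ G₂ s := by
    have h : DifferentiableAt ℂ (fun s : ℂ => (Complex.Gamma ((2 - s) / 2))⁻¹) s :=
      (Complex.differentiable_one_div_Gamma _).comp s
        (f := fun s : ℂ => (2 - s) / 2) (by fun_prop)
    have hZ : DifferentiableAt ℂ (fun s : ℂ => signZeta Ψ (1 - s)) s :=
      (Ψ.differentiableAt_signZeta (s := 1 - s) (by simpa using hs)).comp s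
        (f := fun s : ℂ => 1 - s) (by fun_prop)
    have hp {f : ℂ → ℂ} (hf : DifferentiableAt ℂ f s) :
        DifferentiableAt ℂ (fun s => (1 / (Real.pi : ℂ)) ^ f s) s :=
      hf.const_cpow (Or.inl hpi)
    exact (((((hp (by fun_prop)).pow 2).mul hZ).mul ((hp (by fun_prop)).pow 2)).mul
      (h.pow 2)).neg
  have heq {s : ℂ} (hs : 0 < s.re) (hs1 : s.re < 1) : G₁ s = G₂ s := by
    have h := SchwartzMap.signZeta_functional_equation hΨ hs hs1
    have h1 := hΓ hs
    have h2 : Complex.Gamma ((2 - s) / 2) ≠ 0 :=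
      Complex.Gamma_ne_zero_of_re_pos (by simp; linarith)
    have h3 : (1 / (Real.pi : ℂ)) ^ ((2 - s) / 2) ≠ 0 := by simp [Complex.cpow_eq_zero_iff]
    simp only [G₁, G₂, Complex.cpow_neg]
    generalize (1 / (Real.pi : ℂ)) ^ ((2 - s) / 2) = a at *
    generalize (1 / (Real.pi : ℂ)) ^ ((s + 1) / 2) = b at *
    field_simp
    linear_combination h
  refine ⟨fun s => if 0 < s.re then G₁ s else G₂ s, fun s => ?_, fun s hs => ?_⟩
  · rcases lt_or_ge 0 s.re with hs | hs
    · refine (hG₁ hs).congr_of_eventuallyEq ?_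
      filter_upwards [(isOpen_lt continuous_const Complex.continuous_re).mem_nhds hs] with z hz
      exact if_pos hz
    · refine (hG₂ (by linarith)).congr_of_eventuallyEq ?_
      filter_upwards [(isOpen_lt Complex.continuous_re continuous_const).mem_nhds
        (show s.re < 1 by linarith)] with z hz
      split_ifs with h
      · exact heq h hz
      · rfl
  · have h := hΓ hs
    simp only [if_pos hs, G₁]
    field_simp

/-- The sign-twisted Mellin transform of split orbital integrals of a Schwartz function on `ℝ²`:
`Z(s) = ∫ Φ(x,y) sgn(xy) |xy|^{s-1} dx dy` converges for `Re s > 0` and equals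
`Γ((s+1)/2)²·G(s)` with `G` entire; in particular it extends holomorphically past `s = 0`. -/
theorem stmt_9 (Φ : SchwartzMap (ℝ × ℝ) ℂ) :
    (∀ s : ℂ, 0 < s.re →
      Integrable (fun q : ℝ × ℝ =>
        Φ q * ((Real.sign (q.1 * q.2) : ℝ) : ℂ) * ((|q.1 * q.2| : ℝ) : ℂ) ^ (s - 1))) ∧
    ∃ G : ℂ → ℂ, Differentiable ℂ G ∧
      (∀ s : ℂ, 0 < s.re →
        (∫ q : ℝ × ℝ,
            Φ q * ((Real.sign (q.1 * q.2) : ℝ) : ℂ) * ((|q.1 * q.2| : ℝ) : ℂ) ^ (s - 1)) =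
          Complex.Gamma ((s + 1) / 2) ^ 2 * G s) := by
  have key (s : ℂ) (q : ℝ × ℝ) : Φ q * ((Real.sign (q.1 * q.2) : ℝ) : ℂ) *
      ((|q.1 * q.2| : ℝ) : ℂ) ^ (s - 1) = Φ q * signChar s (q.1 * q.2) := mul_assoc _ _ _
  simp_rw [key]
  exact ⟨fun s hs => Φ.integrable_mul_signChar hs, Φ.exists_differentiable_signZeta_eq⟩
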